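/- Let N⁺_{I,J}(X) denote the number of eligible pairs (I₀,J₀) with Δ(I₀,J₀) > 0 and H(I₀,J₀) < X, and N⁻_{I,J}(X) the number with Δ(I₀,J₀) < 0 and H(I₀,J₀) < X. Then there exists a constant C such that for all real X ≥ 1, |N⁺_{I,J}(X) − (32/135)·X^{5/6}| ≤ C·X^{1/2} and |N⁻_{I,J}(X) − (128/135)·X^{5/6}| ≤ C·X^{1/2}. -/

import Mathlib

open MvPolynomial

/-- The action of a 3×3 matrix on ternary forms: `(γ·f)(x,y,z) = f((x,y,z)·γ)`. -/
noncomputable def actGL {R : Type*} [CommRing R] (γ : Matrix (Fin 3) (Fin 3) R)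
    (f : MvPolynomial (Fin 3) R) : MvPolynomial (Fin 3) R :=
  bind₁ (fun j => ∑ i : Fin 3, C (γ i j) * X i) f

/-- The Hessian of a ternary form: the determinant of the matrix of second partials. -/
noncomputable def hess {R : Type*} [CommRing R] (f : MvPolynomial (Fin 3) R) :
    MvPolynomial (Fin 3) R :=
  Matrix.det (Matrix.of fun i j => pderiv i (pderiv j f))

/-- The exponent vectors of the ten monomials of a ternary cubic form. -/
def expo : Fin 10 → Fin 3 → ℕ :=
  ![![3,0,0], ![0,3,0], ![0,0,3], ![2,1,0], ![2,0,1],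
    ![1,2,0], ![0,2,1], ![1,0,2], ![0,1,2], ![1,1,1]]

/-- The ternary cubic form with coefficient vector `c : Fin 10 → R`. -/
noncomputable def cubic {R : Type*} [CommRing R] (c : Fin 10 → R) : MvPolynomial (Fin 3) R :=
  ∑ k : Fin 10, C (c k) * ∏ i : Fin 3, X i ^ expo k i

/-- The coefficient vector of the Weierstrass cubic `x³ + A·x·z² + B·z³ − y²·z`. -/
noncomputable def wcoeffs {R : Type*} [CommRing R] (A B : R) : Fin 10 → R :=
  ![1, 0, B, 0, 0, 0, -1, A, 0, 0]

/-- The generic ternary cubic form, whose coefficients are the 10 indeterminates. -/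
noncomputable def genCubic (R : Type*) [CommRing R] :
    MvPolynomial (Fin 3) (MvPolynomial (Fin 10) R) :=
  cubic (fun k => X k)

/-- `P` and `Q` are the invariants `I` and `J`: they are homogeneous of degrees 4 and 6
in the ten coefficients, they satisfy the identity
`H(H(f)) = 12288·I(f)²·f + 512·J(f)·H(f)` (stated for the generic ternary cubic form,
hence for every ternary cubic form over every commutative `R`-algebra), and they are
normalized so that `x³ + A·x·z² + B·z³ − y²·z` has `I = −3A` and `J = −27B`. -/
def IsInvariantPair (R : Type*) [CommRing R] (P Q : MvPolynomial (Fin 10) R) : Prop :=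
  P.IsHomogeneous 4 ∧ Q.IsHomogeneous 6 ∧
  hess (hess (genCubic R)) =
    12288 * C P ^ 2 * genCubic R + 512 * C Q * hess (genCubic R) ∧
  ∀ A B : R, aeval (wcoeffs A B) P = -3 * A ∧ aeval (wcoeffs A B) Q = -27 * B

/-- `(I₀, J₀)` occurs as the pair of invariants of some integral ternary cubic form. -/
def Eligible (P Q : MvPolynomial (Fin 10) ℚ) (I₀ J₀ : ℚ) : Prop :=
  ∃ c : Fin 10 → ℤ, aeval (fun k => ((c k : ℚ))) P = I₀ ∧ aeval (fun k => ((c k : ℚ))) Q = J₀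

/-- The discriminant `Δ(I₀,J₀) = (4I₀³ − J₀²)/27` of a pair. -/
noncomputable def Δpair (p : ℚ × ℚ) : ℚ := (4 * p.1 ^ 3 - p.2 ^ 2) / 27

/-- The height `H(I₀,J₀) = max(|I₀|³, J₀²/4)` of a pair. -/
noncomputable def Hpair (p : ℚ × ℚ) : ℚ := max (|p.1| ^ 3) (p.2 ^ 2 / 4)

/-- `c₄` of a generalized Weierstrass equation. -/
def wc4 {R : Type*} [CommRing R] (a1 a2 a3 a4 : R) : R :=
  (a1 ^ 2 + 4 * a2) ^ 2 - 24 * (2 * a4 + a1 * a3)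

/-- `c₆` of a generalized Weierstrass equation. -/
def wc6 {R : Type*} [CommRing R] (a1 a2 a3 a4 a6 : R) : R :=
  -(a1 ^ 2 + 4 * a2) ^ 3 + 36 * (a1 ^ 2 + 4 * a2) * (2 * a4 + a1 * a3)
    - 216 * (a3 ^ 2 + 4 * a6)

/-- Coefficients of the Hessian of a ternary cubic. -/
def hc {R : Type*} [CommRing R] (c : Fin 10 → R) : Fin 10 → R :=
  ![24*c 0*c 5*c 7 - 6*c 0*c 9^2 - 8*c 3^2*c 7 + 8*c 3*c 4*c 9 - 8*c 4^2*c 5,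
    24*c 1*c 3*c 8 - 6*c 1*c 9^2 - 8*c 3*c 6^2 - 8*c 5^2*c 8 + 8*c 5*c 6*c 9,
    24*c 2*c 4*c 6 - 6*c 2*c 9^2 - 8*c 4*c 8^2 - 8*c 6*c 7^2 + 8*c 7*c 8*c 9,
    72*c 0*c 1*c 7 + 24*c 0*c 5*c 8 - 24*c 0*c 6*c 9 - 24*c 1*c 4^2 - 8*c 3^2*c 8
    + 16*c 3*c 4*c 6 - 8*c 3*c 5*c 7 + 2*c 3*c 9^2,
    72*c 0*c 2*c 5 + 24*c 0*c 6*c 7 - 24*c 0*c 8*c 9 - 24*c 2*c 3^2 + 16*c 3*c 4*c 8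
    - 8*c 4^2*c 6 - 8*c 4*c 5*c 7 + 2*c 4*c 9^2,
    72*c 0*c 1*c 8 - 24*c 0*c 6^2 + 24*c 1*c 3*c 7 - 24*c 1*c 4*c 9 - 8*c 3*c 5*c 8
    + 16*c 4*c 5*c 6 - 8*c 5^2*c 7 + 2*c 5*c 9^2,
    72*c 1*c 2*c 3 + 24*c 1*c 4*c 8 - 24*c 1*c 7*c 9 - 24*c 2*c 5^2 - 8*c 3*c 6*c 8
    - 8*c 4*c 6^2 + 16*c 5*c 6*c 7 + 2*c 6*c 9^2,
    72*c 0*c 2*c 6 - 24*c 0*c 8^2 - 24*c 2*c 3*c 9 + 24*c 2*c 4*c 5 + 16*c 3*c 7*c 8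
    - 8*c 4*c 6*c 7 - 8*c 5*c 7^2 + 2*c 7*c 9^2,
    72*c 1*c 2*c 4 - 24*c 1*c 7^2 + 24*c 2*c 3*c 6 - 24*c 2*c 5*c 9 - 8*c 3*c 8^2
    - 8*c 4*c 6*c 8 + 16*c 5*c 7*c 8 + 2*c 8*c 9^2,
    216*c 0*c 1*c 2 - 24*c 0*c 6*c 8 - 24*c 1*c 4*c 7 - 24*c 2*c 3*c 5 + 24*c 3*c 6*c 7
    - 8*c 3*c 8*c 9 + 24*c 4*c 5*c 8 - 8*c 4*c 6*c 9 - 8*c 5*c 7*c 9 + 2*c 9^3]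

/-- Weierstrass coefficient of the Jacobian of a ternary cubic (Artin, Rodriguez-Villegas, Tate). -/
def jac2 {R : Type*} [CommRing R] (c : Fin 10 → R) : R :=
    - c 3*c 8 - c 4*c 6 - c 5*c 7

/-- Weierstrass coefficient of the Jacobian of a ternary cubic (Artin, Rodriguez-Villegas, Tate). -/
def jac3 {R : Type*} [CommRing R] (c : Fin 10 → R) : R :=
    9*c 0*c 1*c 2 - c 0*c 6*c 8 - c 1*c 4*c 7 - c 2*c 3*c 5 - c 3*c 6*c 7 - c 4*c 5*c 8

/-- Weierstrass coefficient of the Jacobian of a ternary cubic (Artin, Rodriguez-Villegas, Tate). -/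
def jac4 {R : Type*} [CommRing R] (c : Fin 10 → R) : R :=
    - 3*c 0*c 1*c 7*c 8 - 3*c 0*c 2*c 5*c 6 + c 0*c 5*c 8^2 + c 0*c 6^2*c 7 - 3*c 1*c 2*c 3*c 4
    + c 1*c 3*c 7^2 + c 1*c 4^2*c 8 + c 2*c 3^2*c 6 + c 2*c 4*c 5^2 + c 3*c 4*c 6*c 8
    + c 3*c 5*c 7*c 8 + c 4*c 5*c 6*c 7

/-- Weierstrass coefficient of the Jacobian of a ternary cubic (Artin, Rodriguez-Villegas, Tate). -/
def jac6 {R : Type*} [CommRing R] (c : Fin 10 → R) : R :=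
    - 27*c 0^2*c 1^2*c 2^2 + 9*c 0^2*c 1*c 2*c 6*c 8 - c 0^2*c 1*c 8^3 - c 0^2*c 2*c 6^3
    + 9*c 0*c 1^2*c 2*c 4*c 7 - c 0*c 1^2*c 7^3 + 9*c 0*c 1*c 2^2*c 3*c 5
    + 3*c 0*c 1*c 2*c 3*c 6*c 7 - 3*c 0*c 1*c 2*c 3*c 8*c 9 + 3*c 0*c 1*c 2*c 4*c 5*c 8
    - 3*c 0*c 1*c 2*c 4*c 6*c 9 - 3*c 0*c 1*c 2*c 5*c 7*c 9 + c 0*c 1*c 2*c 9^3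
    + 2*c 0*c 1*c 3*c 7*c 8^2 - c 0*c 1*c 4*c 6*c 7*c 8 + c 0*c 1*c 4*c 8^2*c 9
    + 2*c 0*c 1*c 5*c 7^2*c 8 + c 0*c 1*c 6*c 7^2*c 9 - c 0*c 1*c 7*c 8*c 9^2 - c 0*c 2^2*c 5^3
    - c 0*c 2*c 3*c 5*c 6*c 8 + c 0*c 2*c 3*c 6^2*c 9 + 2*c 0*c 2*c 4*c 5*c 6^2
    + 2*c 0*c 2*c 5^2*c 6*c 7 + c 0*c 2*c 5^2*c 8*c 9 - c 0*c 2*c 5*c 6*c 9^2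
    - c 0*c 3*c 6^2*c 7*c 8 - c 0*c 4*c 5*c 6*c 8^2 - c 0*c 5^2*c 7*c 8^2 - c 0*c 5*c 6^2*c 7^2
    + c 0*c 5*c 6*c 7*c 8*c 9 - c 1^2*c 2*c 4^3 - c 1*c 2^2*c 3^3 + 2*c 1*c 2*c 3^2*c 4*c 8
    + c 1*c 2*c 3^2*c 7*c 9 + 2*c 1*c 2*c 3*c 4^2*c 6 - c 1*c 2*c 3*c 4*c 5*c 7
    - c 1*c 2*c 3*c 4*c 9^2 + c 1*c 2*c 4^2*c 5*c 9 - c 1*c 3^2*c 7^2*c 8 - c 1*c 3*c 4^2*c 8^2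
    - c 1*c 3*c 4*c 6*c 7^2 + c 1*c 3*c 4*c 7*c 8*c 9 - c 1*c 4^2*c 5*c 7*c 8
    - c 2*c 3^2*c 4*c 6^2 - c 2*c 3^2*c 5*c 6*c 7 - c 2*c 3*c 4*c 5^2*c 8
    + c 2*c 3*c 4*c 5*c 6*c 9 - c 2*c 4^2*c 5^2*c 6 - c 3*c 4*c 5*c 6*c 7*c 8

/-- `c₄` of the Jacobian. -/
def jc4 {R : Type*} [CommRing R] (c : Fin 10 → R) : R := wc4 (c 9) (jac2 c) (jac3 c) (jac4 c)

/-- `c₆` of the Jacobian. -/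
def jc6 {R : Type*} [CommRing R] (c : Fin 10 → R) : R :=
  wc6 (c 9) (jac2 c) (jac3 c) (jac4 c) (jac6 c)

lemma hess_cubic {R : Type*} [CommRing R] (c : Fin 10 → R) :
    hess (cubic c) = cubic (hc c) := by
  have hcub : ∀ d : Fin 10 → R, cubic d = C (d 0) * X 0 ^ 3 + C (d 1) * X 1 ^ 3 + C (d 2) * X 2 ^ 3
      + C (d 3) * X 0 ^ 2 * X 1 + C (d 4) * X 0 ^ 2 * X 2 + C (d 5) * X 0 * X 1 ^ 2
      + C (d 6) * X 1 ^ 2 * X 2 + C (d 7) * X 0 * X 2 ^ 2 + C (d 8) * X 1 * X 2 ^ 2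
      + C (d 9) * X 0 * X 1 * X 2 := by
    intro d
    simp [cubic, Fin.sum_univ_succ, Fin.prod_univ_succ, expo]
    ring
  rw [hess, Matrix.det_fin_three, hcub c, hcub (hc c)]
  simp only [Matrix.of_apply, map_add, Derivation.leibniz, Derivation.leibniz_pow, pderiv_C, 
    pderiv_X_self, smul_eq_mul, nsmul_eq_mul,
    pderiv_X_of_ne (show (1 : Fin 3) ≠ 0 by decide), pderiv_X_of_ne (show (2 : Fin 3) ≠ 0 by decide),
    pderiv_X_of_ne (show (0 : Fin 3) ≠ 1 by decide), pderiv_X_of_ne (show (2 : Fin 3) ≠ 1 by decide),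
    pderiv_X_of_ne (show (0 : Fin 3) ≠ 2 by decide), pderiv_X_of_ne (show (1 : Fin 3) ≠ 2 by decide),
    mul_zero, zero_mul, add_zero, zero_add, mul_one, Derivation.map_natCast,
    Nat.add_one_sub_one, pow_one]
  have hC : ∀ n : ℕ, ∀ _ : n.AtLeastTwo, (C (OfNat.ofNat n : R) : MvPolynomial (Fin 3) R) =
      OfNat.ofNat n := fun n _ => map_ofNat C n
  simp [hc, hC]
  ring

lemma hc_hc_zero {R : Type*} [CommRing R] (c : Fin 10 → R) :
    hc (hc c) 0 = 48 * jc4 c ^ 2 * c 0 + 16 * jc6 c * hc c 0 := by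
  simp only [jc4, jc6, wc4, wc6, jac2, jac3, jac4, jac6]
  simp [hc]
  generalize c 0 = c0, c 1 = c1, c 2 = c2, c 3 = c3, c 4 = c4, c 5 = c5, c 6 = c6, c 7 = c7,
    c 8 = c8, c 9 = c9
  ring


lemma hc_hc_one {R : Type*} [CommRing R] (c : Fin 10 → R) :
    hc (hc c) 1 = 48 * jc4 c ^ 2 * c 1 + 16 * jc6 c * hc c 1 := by
  simp only [jc4, jc6, wc4, wc6, jac2, jac3, jac4, jac6]
  simp [hc]
  generalize c 0 = c0, c 1 = c1, c 2 = c2, c 3 = c3, c 4 = c4, c 5 = c5, c 6 = c6, c 7 = c7,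
    c 8 = c8, c 9 = c9
  ring

lemma eval_cubic_zero {R : Type*} [CommRing R] (c : Fin 10 → R) :
    eval ![1, 0, 0] (cubic c) = c 0 := by
  simp [cubic, Fin.sum_univ_succ, Fin.prod_univ_succ, expo]

lemma eval_cubic_one {R : Type*} [CommRing R] (c : Fin 10 → R) :
    eval ![0, 1, 0] (cubic c) = c 1 := by
  simp [cubic, Fin.sum_univ_succ, Fin.prod_univ_succ, expo]

lemma map_jc4 {R S : Type*} [CommRing R] [CommRing S] (φ : R →+* S) (c : Fin 10 → R) :
    φ (jc4 c) = jc4 (fun k => φ (c k)) := by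
  have hC : ∀ n : ℕ, ∀ _ : n.AtLeastTwo, φ (OfNat.ofNat n : R) = OfNat.ofNat n :=
    fun n _ => map_ofNat φ n
  simp [jc4, wc4, jac2, jac3, jac4, hC]

lemma map_jc6 {R S : Type*} [CommRing R] [CommRing S] (φ : R →+* S) (c : Fin 10 → R) :
    φ (jc6 c) = jc6 (fun k => φ (c k)) := by
  have hC : ∀ n : ℕ, ∀ _ : n.AtLeastTwo, φ (OfNat.ofNat n : R) = OfNat.ofNat n :=
    fun n _ => map_ofNat φ n
  simp [jc6, wc6, jac2, jac3, jac4, jac6, hC]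

lemma map_hc_zero {R S : Type*} [CommRing R] [CommRing S] (φ : R →+* S) (c : Fin 10 → R) :
    φ (hc c 0) = hc (fun k => φ (c k)) 0 := by
  have hC : ∀ n : ℕ, ∀ _ : n.AtLeastTwo, φ (OfNat.ofNat n : R) = OfNat.ofNat n :=
    fun n _ => map_ofNat φ n
  simp [hc, hC]

lemma map_hc_one {R S : Type*} [CommRing R] [CommRing S] (φ : R →+* S) (c : Fin 10 → R) :
    φ (hc c 1) = hc (fun k => φ (c k)) 1 := by
  have hC : ∀ n : ℕ, ∀ _ : n.AtLeastTwo, φ (OfNat.ofNat n : R) = OfNat.ofNat n :=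
    fun n _ => map_ofNat φ n
  simp [hc, hC]

/-- The invariants are, up to scaling, the `c₄`, `c₆` of the Jacobian. -/
lemma invariant_eq (P Q : MvPolynomial (Fin 10) ℚ) (hPQ : IsInvariantPair ℚ P Q) :
    16 * P = jc4 (fun k => X k) ∧ 32 * Q = jc6 (fun k => X k) := by
  obtain ⟨-, -, hid, hnorm⟩ := hPQ
  rw [genCubic, hess_cubic, hess_cubic] at hid
  have h0 := congrArg (eval ![1, 0, 0]) hid
  have h1 := congrArg (eval ![0, 1, 0]) hid
  simp only [map_add, map_mul, map_pow, map_ofNat, eval_C, eval_cubic_zero] at h0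
  simp only [map_add, map_mul, map_pow, map_ofNat, eval_C, eval_cubic_one] at h1
  rw [hc_hc_zero] at h0
  rw [hc_hc_one] at h1
  have hD : (X 0 * hc (fun k => X k) 1 - X 1 * hc (fun k => X k) 0 : MvPolynomial (Fin 10) ℚ) ≠ 0 := by
    intro h
    have := congrArg (eval (![1, 0, 0, 1, 0, 0, 1, 0, 0, 0] : Fin 10 → ℚ)) h
    simp only [map_sub, map_mul, eval_X, map_zero] at this
    rw [map_hc_zero (eval (![1, 0, 0, 1, 0, 0, 1, 0, 0, 0] : Fin 10 → ℚ)), 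
      map_hc_one (eval (![1, 0, 0, 1, 0, 0, 1, 0, 0, 0] : Fin 10 → ℚ))] at this
    simp [hc] at this
  set H0 := hc (fun k => (X k : MvPolynomial (Fin 10) ℚ)) 0
  set H1 := hc (fun k => (X k : MvPolynomial (Fin 10) ℚ)) 1
  set c4 := jc4 (fun k => (X k : MvPolynomial (Fin 10) ℚ)) with hc4
  set c6 := jc6 (fun k => (X k : MvPolynomial (Fin 10) ℚ)) with hc6
  have hP : (X 0 * H1 - X 1 * H0) * (48 * ((16 * P) ^ 2 - c4 ^ 2)) = 0 := by
    linear_combination H0 * h1 - H1 * h0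
  have hQ : (X 0 * H1 - X 1 * H0) * (16 * (32 * Q - c6)) = 0 := by
    linear_combination X 1 * h0 - X 0 * h1
  have n48 : (48 : MvPolynomial (Fin 10) ℚ) ≠ 0 := by norm_num
  have n16 : (16 : MvPolynomial (Fin 10) ℚ) ≠ 0 := by norm_num
  have hQ' : 32 * Q - c6 = 0 := by simpa [hD, n16] using hQ
  have hP' : (16 * P) ^ 2 - c4 ^ 2 = 0 := by simpa [hD, n48] using hP
  refine ⟨?_, sub_eq_zero.mp hQ'⟩
  rcases sq_eq_sq_iff_eq_or_eq_neg.mp (sub_eq_zero.mp hP') with h | h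
  · exact h
  · exfalso
    have h2 := congrArg (aeval (wcoeffs (1 : ℚ) 0)) h
    rw [map_mul, (hnorm 1 0).1, map_neg, hc4] at h2
    have h3 := map_jc4 ((aeval (wcoeffs (1 : ℚ) 0)) : MvPolynomial (Fin 10) ℚ →ₐ[ℚ] ℚ).toRingHom
      (fun k => X k)
    simp only [AlgHom.toRingHom_eq_coe, RingHom.coe_coe] at h3
    rw [h3] at h2
    simp [jc4, wc4, jac2, jac3, jac4, wcoeffs] at h2
    norm_num at h2

lemma eligible_iff (P Q : MvPolynomial (Fin 10) ℚ) (hPQ : IsInvariantPair ℚ P Q) (I J : ℚ) :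
    Eligible P Q I J ↔ ∃ a1 a2 a3 a4 a6 : ℤ,
      16 * I = (wc4 a1 a2 a3 a4 : ℤ) ∧ 32 * J = (wc6 a1 a2 a3 a4 a6 : ℤ) := by
  obtain ⟨hP, hQ⟩ := invariant_eq P Q hPQ
  have key : ∀ c : Fin 10 → ℤ, 16 * aeval (fun k => ((c k : ℚ))) P = (jc4 c : ℤ) ∧
      32 * aeval (fun k => ((c k : ℚ))) Q = (jc6 c : ℤ) := by
    intro c
    constructor
    · have h2 := congrArg (aeval (fun k => ((c k : ℚ)))) hP
      have h3 := map_jc4 ((aeval (fun k => ((c k : ℚ)))) : MvPolynomial (Fin 10) ℚ →ₐ[ℚ] ℚ).toRingHom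
        (fun k => X k)
      simp only [AlgHom.toRingHom_eq_coe, RingHom.coe_coe] at h3
      rw [h3, map_mul] at h2
      have h4 := map_jc4 (Int.castRingHom ℚ) c
      simp at h2 h4
      rw [h4, ← h2]
      simp
    · have h2 := congrArg (aeval (fun k => ((c k : ℚ)))) hQ
      have h3 := map_jc6 ((aeval (fun k => ((c k : ℚ)))) : MvPolynomial (Fin 10) ℚ →ₐ[ℚ] ℚ).toRingHom
        (fun k => X k)
      simp only [AlgHom.toRingHom_eq_coe, RingHom.coe_coe] at h3
      rw [h3, map_mul] at h2
      have h4 := map_jc6 (Int.castRingHom ℚ) c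
      simp at h2 h4
      rw [h4, ← h2]
      simp
  constructor
  · rintro ⟨c, rfl, rfl⟩
    exact ⟨c 9, jac2 c, jac3 c, jac4 c, jac6 c, (key c).1, (key c).2⟩
  · rintro ⟨a1, a2, a3, a4, a6, h1, h2⟩
    refine ⟨![1, 0, a6, 0, a2, 0, -1, a4, -a3, -a1], ?_, ?_⟩
    · have h := (key ![1, 0, a6, 0, a2, 0, -1, a4, -a3, -a1]).1
      have e : jc4 ![1, 0, a6, 0, a2, 0, -1, a4, -a3, -a1] = wc4 a1 a2 a3 a4 := by
        simp [jc4, wc4, jac2, jac3, jac4]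
      rw [e] at h
      linarith
    · have h := (key ![1, 0, a6, 0, a2, 0, -1, a4, -a3, -a1]).2
      have e : jc6 ![1, 0, a6, 0, a2, 0, -1, a4, -a3, -a1] = wc6 a1 a2 a3 a4 a6 := by
        simp [jc6, wc6, jac2, jac3, jac4, jac6]
      rw [e] at h
      linarith

/-- Reduction of a generalized Weierstrass equation. -/
lemma reduce (a1 a2 a3 a4 a6 : ℤ) : ∃ b1 ∈ Finset.Icc (0:ℤ) 1, ∃ b2 ∈ Finset.Icc (-1 : ℤ) 1,
    ∃ b3 ∈ Finset.Icc (0:ℤ) 1, ∃ b4 b6 : ℤ,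
    wc4 a1 a2 a3 a4 = wc4 b1 b2 b3 b4 ∧ wc6 a1 a2 a3 a4 a6 = wc6 b1 b2 b3 b4 b6 := by
  have s1 : ∃ b1 ∈ Finset.Icc (0:ℤ) 1, ∃ b2 b3 b4 b6 : ℤ,
    wc4 a1 a2 a3 a4 = wc4 b1 b2 b3 b4 ∧ wc6 a1 a2 a3 a4 a6 = wc6 b1 b2 b3 b4 b6 := by
    refine ⟨a1 + 2 * (-(a1 / 2)), by simp; omega, a2 - (-(a1 / 2)) * a1 - (-(a1 / 2)) ^ 2, a3,
      a4 - (-(a1 / 2)) * a3, a6, ?_, ?_⟩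
    · generalize -(a1 / 2) = s
      simp only [wc4]; ring
    · generalize -(a1 / 2) = s
      simp only [wc6]; ring
  obtain ⟨b1, hb1, a2, a3, a4, a6, e4, e6⟩ := s1
  rw [e4, e6]
  clear e4 e6
  have s2 : ∃ b2 ∈ Finset.Icc (-1:ℤ) 1, ∃ b3 b4 b6 : ℤ,
    wc4 b1 a2 a3 a4 = wc4 b1 b2 b3 b4 ∧ wc6 b1 a2 a3 a4 a6 = wc6 b1 b2 b3 b4 b6 := by
    refine ⟨a2 + 3 * (-((a2 + 1) / 3)), by simp; omega, a3 + (-((a2 + 1) / 3)) * b1,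
      a4 + 2 * (-((a2 + 1) / 3)) * a2 + 3 * (-((a2 + 1) / 3)) ^ 2, 
      a6 + (-((a2 + 1) / 3)) * a4 + (-((a2 + 1) / 3)) ^ 2 * a2 + (-((a2 + 1) / 3)) ^ 3, ?_, ?_⟩
    · generalize -((a2 + 1) / 3) = s
      simp only [wc4]; ring
    · generalize -((a2 + 1) / 3) = s
      simp only [wc6]; ring
  obtain ⟨b2, hb2, a3, a4, a6, e4, e6⟩ := s2
  rw [e4, e6]
  clear e4 e6
  refine ⟨b1, hb1, b2, hb2, a3 + 2 * (-(a3 / 2)), by simp; omega, a4 - (-(a3 / 2)) * b1,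
    a6 - (-(a3 / 2)) * a3 - (-(a3 / 2)) ^ 2, ?_, ?_⟩
  · generalize -(a3 / 2) = s
    simp only [wc4]; ring
  · generalize -(a3 / 2) = s
    simp only [wc6]; ring

lemma reduced_inj {a1 a2 a3 a4 a6 b1 b2 b3 b4 b6 : ℤ} 
    (ha1 : a1 ∈ Finset.Icc (0:ℤ) 1) (ha2 : a2 ∈ Finset.Icc (-1 : ℤ) 1)
    (ha3 : a3 ∈ Finset.Icc (0:ℤ) 1)
    (hb1 : b1 ∈ Finset.Icc (0:ℤ) 1) (hb2 : b2 ∈ Finset.Icc (-1 : ℤ) 1)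
    (hb3 : b3 ∈ Finset.Icc (0:ℤ) 1)
    (h4 : wc4 a1 a2 a3 a4 = wc4 b1 b2 b3 b4) (h6 : wc6 a1 a2 a3 a4 a6 = wc6 b1 b2 b3 b4 b6) :
    a1 = b1 ∧ a2 = b2 ∧ a3 = b3 ∧ a4 = b4 ∧ a6 = b6 := by
  simp only [Finset.mem_Icc] at *
  obtain ⟨l1, u1⟩ := ha1
  obtain ⟨l2, u2⟩ := ha2
  obtain ⟨l3, u3⟩ := ha3
  obtain ⟨m1, v1⟩ := hb1
  obtain ⟨m2, v2⟩ := hb2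
  obtain ⟨m3, v3⟩ := hb3
  unfold wc4 at h4
  unfold wc6 at h6
  interval_cases a1 <;> interval_cases b1 <;> interval_cases a2 <;> interval_cases b2 <;> 
    interval_cases a3 <;> interval_cases b3 <;> omega

/-- Counting points of an arithmetic progression in an interval. -/
lemma card_prog {d : ℝ} (hd : 0 < d) (b w : ℝ) (hw : 0 ≤ w) (S : Set ℤ)
    (h1 : ∀ n : ℤ, |b - d * n| < w → n ∈ S) (h2 : ∀ n ∈ S, |b - d * n| ≤ w) :
    S.Finite ∧ |(S.ncard : ℝ) - 2 * w / d| ≤ 1 := by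
  have hsub : S ⊆ ↑(Finset.Icc ⌈(b - w) / d⌉ ⌊(b + w) / d⌋) := by
    intro n hn
    have := abs_le.mp (h2 n hn)
    simp only [Finset.coe_Icc, Set.mem_Icc, Int.ceil_le, Int.le_floor]
    rw [div_le_iff₀ hd, le_div_iff₀ hd]
    constructor <;> nlinarith
  have hsup : ↑(Finset.Ioo ⌊(b - w) / d⌋ ⌈(b + w) / d⌉) ⊆ S := by
    intro n hn
    simp only [Finset.coe_Ioo, Set.mem_Ioo, Int.floor_lt, Int.lt_ceil] at hn
    rw [div_lt_iff₀ hd, lt_div_iff₀ hd] at hn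
    apply h1
    rw [abs_lt]
    constructor <;> nlinarith [hn.1, hn.2]
  have hfin : S.Finite := (Finset.finite_toSet _).subset hsub
  refine ⟨hfin, ?_⟩
  have l1 := Set.ncard_le_ncard hsub (Finset.finite_toSet _)
  have l2 := Set.ncard_le_ncard hsup hfin
  rw [Set.ncard_coe_finset, Int.card_Icc] at l1
  rw [Set.ncard_coe_finset, Int.card_Ioo] at l2
  have e : (b + w) / d - (b - w) / d = 2 * w / d := by ring
  have hpos : 0 ≤ 2 * w / d := by positivity
  have f1 := Int.floor_le ((b + w) / d)
  have f2 := Int.le_ceil ((b - w) / d)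
  have f3 := Int.floor_le ((b - w) / d)
  have f4 := Int.le_ceil ((b + w) / d)
  rw [abs_le]
  constructor
  · have : ⌈(b + w) / d⌉ - ⌊(b - w) / d⌋ - 1 ≤ (S.ncard : ℤ) := by omega
    have : ((⌈(b + w) / d⌉ : ℝ) - ⌊(b - w) / d⌋ - 1) ≤ (S.ncard : ℝ) := by exact_mod_cast this
    linarith
  · have : (S.ncard : ℤ) ≤ max (⌊(b + w) / d⌋ + 1 - ⌈(b - w) / d⌉) 0 := by omega
    have : (S.ncard : ℝ) ≤ max ((⌊(b + w) / d⌋ : ℝ) + 1 - ⌈(b - w) / d⌉) 0 := by exact_mod_cast this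
    rcases le_max_iff.mp this with h | h <;> linarith

/-- Counting a set in a product by fibres. -/
lemma ncard_fibre {κ τ : Type*} (A : Set (κ × τ)) (M : Finset κ) (hM : ∀ p ∈ A, p.1 ∈ M)
    (g : κ → ℝ) (e : ℝ)
    (hf : ∀ m ∈ M, {t | (m, t) ∈ A}.Finite ∧ |({t | (m, t) ∈ A}.ncard : ℝ) - g m| ≤ e) :
    A.Finite ∧ |(A.ncard : ℝ) - ∑ m ∈ M, g m| ≤ M.card * e := by
  classical
  have hfin : A.Finite := by
    have : A ⊆ ⋃ m ∈ M, Prod.mk m '' {t | (m, t) ∈ A} := by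
      rintro ⟨m, t⟩ h
      simp only [Set.mem_iUnion]
      exact ⟨m, hM _ h, t, h, rfl⟩
    exact (Set.Finite.biUnion M.finite_toSet (fun m hm => (hf m hm).1.image _)).subset this
  refine ⟨hfin, ?_⟩
  have hc : A.ncard = ∑ m ∈ M, {t | (m, t) ∈ A}.ncard := by
    rw [Set.ncard_eq_toFinset_card A hfin,
      Finset.card_eq_sum_card_fiberwise (f := Prod.fst) (t := M) (by
        intro p hp
        exact hM p (by simpa using hp))]
    refine Finset.sum_congr rfl fun m hm => ?_
    rw [← Set.ncard_coe_finset, ← Set.ncard_image_of_injective {t | (m, t) ∈ A} (Prod.mk_right_injective m)]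
    congr 1
    ext ⟨x, t⟩
    simp
    constructor
    · rintro ⟨h, rfl⟩
      exact ⟨h, rfl⟩
    · rintro ⟨h, rfl⟩
      exact ⟨h, rfl⟩
  rw [hc]
  push_cast
  rw [← Finset.sum_sub_distrib]
  refine (Finset.abs_sum_le_sum_abs _ _).trans ?_
  refine (Finset.sum_le_sum fun m hm => (hf m hm).2).trans ?_
  simp

/-- Convexity of `u ↦ (2/5) u_+^{5/2}`. -/
lemma conv_sqrt (a b : ℝ) : √a ^ 3 * (b - a) ≤ 2 / 5 * √b ^ 5 - 2 / 5 * √a ^ 5 := by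
  have hb := Real.sqrt_nonneg b
  have ha := Real.sqrt_nonneg a
  rcases le_or_gt a 0 with h | h
  · rw [Real.sqrt_eq_zero_of_nonpos h]
    have : 0 ≤ √b ^ 5 := by positivity
    norm_num
  · have ha2 : √a ^ 2 = a := Real.sq_sqrt h.le
    have hb2 : b ≤ √b ^ 2 := by
      rcases le_or_gt b 0 with hb' | hb'
      · exact hb'.trans (by positivity)
      · rw [Real.sq_sqrt hb'.le]
    generalize √a = s at *
    generalize √b = t at *
    have h1 : s ^ 3 * (b - a) ≤ s ^ 3 * (t ^ 2 - s ^ 2) := by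
      apply mul_le_mul_of_nonneg_left _ (by positivity)
      linarith
    have h2 : 0 ≤ (t - s) ^ 2 * (2 * t ^ 3 + 4 * t ^ 2 * s + 6 * t * s ^ 2 + 3 * s ^ 3) := by
      positivity
    nlinarith

lemma telescope (f : ℤ → ℝ) (a b : ℤ) (h : a ≤ b) :
    ∑ m ∈ Finset.Ico a b, (f m - f (m + 1)) = f a - f b := by
  induction b, h using Int.leInduction with
  | base => simp
  | succ n hn ih =>
    rw [← Finset.insert_Ico_right_eq_Ico_add_one hn, Finset.sum_insert (by simp), ih]
    ring

/-- The finset of admissible `m`. -/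
noncomputable def Mset (α s : ℝ) : Finset ℤ :=
  Finset.Ioo ⌊(α - s ^ 2) / 3⌋ ⌈(α + s ^ 2) / 3⌉

lemma mem_Mset (α s : ℝ) (m : ℤ) : m ∈ Mset α s ↔ |α - 3 * m| < s ^ 2 := by
  simp only [Mset, Finset.mem_Ioo, Int.floor_lt, Int.lt_ceil, abs_lt]
  constructor <;> rintro ⟨h1, h2⟩ <;> constructor <;> linarith

lemma card_Mset (α s : ℝ) : |((Mset α s).card : ℝ) - 2 * s ^ 2 / 3| ≤ 1 := by
  have := (card_prog (d := 3) (by norm_num) α (s ^ 2) (by positivity) (Mset α s : Set ℤ)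
    (fun n h => by simpa [mem_Mset] using h)
    (fun n h => by
      have h' : n ∈ Mset α s := by simpa using h
      exact ((mem_Mset _ _ _).mp h').le)).2
  rwa [Set.ncard_coe_finset] at this

lemma sqrt_pow_bound (s : ℝ) (hs : 1 ≤ s) : √(s ^ 2 + 3) ^ 3 ≤ 8 * s ^ 3 := by
  have : √(s ^ 2 + 3) ≤ 2 * s := by
    rw [Real.sqrt_le_left (by linarith)]
    nlinarith
  calc √(s ^ 2 + 3) ^ 3 ≤ (2 * s) ^ 3 := by gcongr
    _ = _ := by ring

lemma sum_Mset (α s : ℝ) (hs : 1 ≤ s) :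
    |∑ m ∈ Mset α s, √(α - 3 * m) ^ 3 - 2 / 15 * s ^ 5| ≤ 8 * s ^ 3 := by
  set a := ⌊(α - s ^ 2) / 3⌋ with ha
  set b := ⌈(α + s ^ 2) / 3⌉ with hb
  have f1 := Int.floor_le ((α - s ^ 2) / 3)
  have f2 := Int.lt_floor_add_one ((α - s ^ 2) / 3)
  have f3 := Int.le_ceil ((α + s ^ 2) / 3)
  have f4 := Int.ceil_lt_add_one ((α + s ^ 2) / 3)
  rw [← ha] at f1 f2
  rw [← hb] at f3 f4
  have hab : a + 1 ≤ b := by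
    have : (a : ℝ) < b := by nlinarith
    exact_mod_cast this
  have hM : Mset α s = Finset.Ico (a + 1) b := by
    ext m
    simp only [Mset, Finset.mem_Ioo, Finset.mem_Ico]
    omega
  set g : ℤ → ℝ := fun m => 2 / 5 * √(α - 3 * m) ^ 5 with hg
  have hg0 : ∀ m, 0 ≤ g m := fun m => by positivity
  have lo : g (a + 1) - g b ≤ 3 * ∑ m ∈ Mset α s, √(α - 3 * m) ^ 3 := by
    rw [hM, Finset.mul_sum, ← telescope g _ _ hab]
    refine Finset.sum_le_sum fun m _ => ?_
    have := conv_sqrt (α - 3 * m) (α - 3 * (m + 1 : ℤ))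
    push_cast at this
    simp only [hg]
    push_cast
    nlinarith
  have hi : 3 * ∑ m ∈ Mset α s, √(α - 3 * m) ^ 3 ≤ g a - g (b - 1) := by
    have t := telescope (fun m => g (m - 1)) _ _ hab
    simp only [add_sub_cancel_right] at t
    rw [hM, Finset.mul_sum, ← t]
    refine Finset.sum_le_sum fun m _ => ?_
    have := conv_sqrt (α - 3 * m) (α - 3 * (m - 1 : ℤ))
    push_cast at this
    simp only [hg]
    push_cast
    nlinarith
  have hb0 : g b = 0 := by
    simp only [hg]
    rw [Real.sqrt_eq_zero_of_nonpos (by nlinarith)]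
    norm_num
  have hss : √(s ^ 2) = s := Real.sqrt_sq (by linarith)
  have up : g a ≤ 2 / 5 * s ^ 5 + 24 * s ^ 3 := by
    have h1 : g a ≤ 2 / 5 * √(s ^ 2 + 3) ^ 5 := by
      simp only [hg]
      have : √(α - 3 * a) ≤ √(s ^ 2 + 3) := Real.sqrt_le_sqrt (by linarith)
      gcongr
    have h2 := conv_sqrt (s ^ 2 + 3) (s ^ 2)
    rw [hss] at h2
    have h3 := sqrt_pow_bound s hs
    nlinarith
  have dn : 2 / 5 * s ^ 5 - 24 * s ^ 3 ≤ g (a + 1) := by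
    have h1 : 2 / 5 * √(s ^ 2 - 3) ^ 5 ≤ g (a + 1) := by
      simp only [hg]
      have : √(s ^ 2 - 3) ≤ √(α - 3 * (a + 1 : ℤ)) := Real.sqrt_le_sqrt (by push_cast; linarith)
      gcongr
    have h2 := conv_sqrt (s ^ 2) (s ^ 2 - 3)
    rw [hss] at h2
    have h3 : 0 ≤ s ^ 3 := by positivity
    nlinarith
  have := hg0 (b - 1)
  rw [abs_le]
  constructor <;> linarith

/-- Positive discriminant region. -/
def Apos (α : ℝ) (β : ℤ → ℝ) (s : ℝ) : Set (ℤ × ℤ) :=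
  {p | (β p.1 - 27 * p.2) ^ 2 < 4 * (α - 3 * p.1) ^ 3 ∧ |α - 3 * p.1| < s ^ 2 ∧
    |β p.1 - 27 * p.2| < 2 * s ^ 3}

/-- Negative discriminant region. -/
def Aneg (α : ℝ) (β : ℤ → ℝ) (s : ℝ) : Set (ℤ × ℤ) :=
  {p | 4 * (α - 3 * p.1) ^ 3 < (β p.1 - 27 * p.2) ^ 2 ∧ |α - 3 * p.1| < s ^ 2 ∧
    |β p.1 - 27 * p.2| < 2 * s ^ 3}

lemma lt_iff_sqrt (I J : ℝ) : J ^ 2 < 4 * I ^ 3 ↔ |J| < 2 * √I ^ 3 := by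
  rcases le_or_gt I 0 with h | h
  · rw [Real.sqrt_eq_zero_of_nonpos h]
    have : I ^ 3 ≤ 0 := by
      have := pow_nonneg (neg_nonneg.mpr h) 3
      nlinarith
    constructor
    · intro h'; nlinarith [sq_nonneg J]
    · intro h'; norm_num at h'; linarith [abs_nonneg J]
  · have e : 4 * I ^ 3 = (2 * √I ^ 3) ^ 2 := by
      have : √I ^ 2 = I := Real.sq_sqrt h.le
      calc 4 * I ^ 3 = 4 * (√I ^ 2) ^ 3 := by rw [this]
        _ = _ := by ring
    rw [e, sq_lt_sq, abs_of_nonneg (a := 2 * √I ^ 3) (by positivity)]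

lemma le_imp_sqrt (I J : ℝ) (h : J ^ 2 ≤ 4 * I ^ 3) : |J| ≤ 2 * √I ^ 3 := by
  have hI : 0 ≤ I := by
    by_contra hI
    have : 0 < (-I) ^ 3 := pow_pos (by linarith) 3
    nlinarith [sq_nonneg J]
  have e : 4 * I ^ 3 = (2 * √I ^ 3) ^ 2 := by
    have : √I ^ 2 = I := Real.sq_sqrt hI
    calc 4 * I ^ 3 = 4 * (√I ^ 2) ^ 3 := by rw [this]
      _ = _ := by ring
  rw [e] at h
  exact abs_le_of_sq_le_sq h (by positivity)

lemma sqrt_cube_lt (I s : ℝ) (hs : 1 ≤ s) (h : |I| < s ^ 2) : √I ^ 3 < s ^ 3 := by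
  have : √I < s := by
    rw [Real.sqrt_lt' (by linarith)]
    exact (abs_lt.mp h).2
  gcongr

lemma count_pos (α : ℝ) (β : ℤ → ℝ) (s : ℝ) (hs : 1 ≤ s) :
    (Apos α β s).Finite ∧ |((Apos α β s).ncard : ℝ) - 8 / 405 * s ^ 5| ≤ 10 * s ^ 3 := by
  have h := ncard_fibre (Apos α β s) (Mset α s) (fun p hp => (mem_Mset _ _ _).mpr hp.2.1)
    (fun m => 4 / 27 * √(α - 3 * m) ^ 3) 1 (by
      intro m hm
      rw [mem_Mset] at hm
      have := card_prog (d := 27) (by norm_num) (β m) (2 * √(α - 3 * m) ^ 3) (by positivity)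
        {n | (m, n) ∈ Apos α β s} (by
          intro n hn
          refine ⟨(lt_iff_sqrt _ _).mpr hn, hm, hn.trans ?_⟩
          have := sqrt_cube_lt _ s hs hm
          linarith) (by
          intro n hn
          exact ((lt_iff_sqrt _ _).mp hn.1).le)
      refine ⟨this.1, ?_⟩
      convert this.2 using 3
      ring)
  refine ⟨h.1, ?_⟩
  have h2 := h.2
  rw [← Finset.mul_sum] at h2
  have h3 := card_Mset α s
  have h4 := sum_Mset α s hs
  rw [abs_le] at *
  have h5 : s ^ 2 ≤ s ^ 3 := pow_le_pow_right₀ hs (by norm_num)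
  have h6 : 1 ≤ s ^ 3 := one_le_pow₀ hs
  constructor <;> linarith [h2.1, h2.2, h3.1, h3.2, h4.1, h4.2]

lemma count_neg (α : ℝ) (β : ℤ → ℝ) (s : ℝ) (hs : 1 ≤ s) :
    (Aneg α β s).Finite ∧ |((Aneg α β s).ncard : ℝ) - 32 / 405 * s ^ 5| ≤ 10 * s ^ 3 := by
  have h := ncard_fibre (Aneg α β s) (Mset α s) (fun p hp => (mem_Mset _ _ _).mpr hp.2.1)
    (fun m => 4 / 27 * s ^ 3 - 4 / 27 * √(α - 3 * m) ^ 3) 2 (by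
      intro m hm
      rw [mem_Mset] at hm
      have hB := card_prog (d := 27) (by norm_num) (β m) (2 * s ^ 3) (by positivity)
        {n : ℤ | |β m - 27 * n| < 2 * s ^ 3} (fun n hn => hn) (fun n hn => le_of_lt hn)
      have hD := card_prog (d := 27) (by norm_num) (β m) (2 * √(α - 3 * m) ^ 3) (by positivity)
        {n : ℤ | (β m - 27 * n) ^ 2 ≤ 4 * (α - 3 * m) ^ 3}
        (fun n hn => Set.mem_ofPred_eq ▸ ((lt_iff_sqrt _ _).mpr hn).le)
        (fun n hn => le_imp_sqrt _ _ (by simpa using hn))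
      have hsub : {n : ℤ | (β m - 27 * n) ^ 2 ≤ 4 * (α - 3 * m) ^ 3} ⊆
          {n : ℤ | |β m - 27 * n| < 2 * s ^ 3} := by
        intro n hn
        have h1 := le_imp_sqrt _ _ hn
        have := sqrt_cube_lt _ s hs hm
        simp only [Set.mem_ofPred_eq]
        linarith
      have e : {n | (m, n) ∈ Aneg α β s} = {n : ℤ | |β m - 27 * n| < 2 * s ^ 3} \
          {n : ℤ | (β m - 27 * n) ^ 2 ≤ 4 * (α - 3 * m) ^ 3} := by
        ext n
        simp only [Aneg, Set.mem_ofPred_eq, Set.mem_sdiff, not_le]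
        tauto
      rw [e]
      refine ⟨hB.1.sdiff, ?_⟩
      have hc := Set.ncard_sdiff_add_ncard_of_subset hsub hB.1
      have hc' := congrArg (Nat.cast : ℕ → ℝ) hc
      push_cast at hc'
      have b2 := hB.2
      have d2 := hD.2
      rw [abs_le] at *
      constructor <;> linarith [b2.1, b2.2, d2.1, d2.2, hc'])
  refine ⟨h.1, ?_⟩
  have h2 := h.2
  rw [Finset.sum_sub_distrib, Finset.sum_const, nsmul_eq_mul, ← Finset.mul_sum] at h2
  have h3 := card_Mset α s
  have h4 := sum_Mset α s hs
  have h5 : s ^ 2 ≤ s ^ 3 := pow_le_pow_right₀ hs (by norm_num)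
  have h6 : 1 ≤ s ^ 3 := one_le_pow₀ hs
  have h7 : |((Mset α s).card : ℝ) * (4 / 27 * s ^ 3) - 8 / 81 * s ^ 5| ≤ 4 / 27 * s ^ 3 := by
    have : ((Mset α s).card : ℝ) * (4 / 27 * s ^ 3) - 8 / 81 * s ^ 5 =
      (((Mset α s).card : ℝ) - 2 * s ^ 2 / 3) * (4 / 27 * s ^ 3) := by ring
    rw [this, abs_mul, abs_of_nonneg (a := 4 / 27 * s ^ 3) (by positivity)]
    exact mul_le_of_le_one_left (by positivity) h3
  rw [abs_le] at *
  constructor <;> linarith [h2.1, h2.2, h3.1, h3.2, h4.1, h4.2, h7.1, h7.2]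

/-- The finite set of reduced `(a₁, a₂, a₃)`. -/
noncomputable def Kset : Finset (ℤ × ℤ × ℤ) := Finset.Icc 0 1 ×ˢ Finset.Icc (-1) 1 ×ˢ Finset.Icc 0 1

/-- Parametrization of the eligible pairs. -/
def Phi (x : (ℤ × ℤ × ℤ) × (ℤ × ℤ)) : ℚ × ℚ :=
  ((wc4 x.1.1 x.1.2.1 x.1.2.2 x.2.1 : ℤ) / 16,
    (wc6 x.1.1 x.1.2.1 x.1.2.2 x.2.1 x.2.2 : ℤ) / 32)

lemma Phi_injOn : Set.InjOn Phi {x | x.1 ∈ Kset} := by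
  rintro ⟨⟨a1, a2, a3⟩, a4, a6⟩ ha ⟨⟨b1, b2, b3⟩, b4, b6⟩ hb h
  have ha' : (a1, a2, a3) ∈ Kset := ha
  have hb' : (b1, b2, b3) ∈ Kset := hb
  rw [Kset, Finset.mem_product, Finset.mem_product] at ha' hb'
  simp only [Phi, Prod.mk.injEq] at h
  have h4 : wc4 a1 a2 a3 a4 = wc4 b1 b2 b3 b4 := by
    have : ((wc4 a1 a2 a3 a4 : ℤ) : ℚ) = (wc4 b1 b2 b3 b4 : ℤ) := by linarith [h.1]
    exact_mod_cast this
  have h6 : wc6 a1 a2 a3 a4 a6 = wc6 b1 b2 b3 b4 b6 := by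
    have : ((wc6 a1 a2 a3 a4 a6 : ℤ) : ℚ) = (wc6 b1 b2 b3 b4 b6 : ℤ) := by linarith [h.2]
    exact_mod_cast this
  obtain ⟨rfl, rfl, rfl, rfl, rfl⟩ := reduced_inj ha'.1 ha'.2.1 ha'.2.2 hb'.1 hb'.2.1 hb'.2.2 h4 h6
  rfl

lemma eligible_iff_Phi (P Q : MvPolynomial (Fin 10) ℚ) (hPQ : IsInvariantPair ℚ P Q) (p : ℚ × ℚ) :
    Eligible P Q p.1 p.2 ↔ ∃ x, x.1 ∈ Kset ∧ Phi x = p := by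
  rw [eligible_iff P Q hPQ]
  constructor
  · rintro ⟨a1, a2, a3, a4, a6, h4, h6⟩
    obtain ⟨b1, hb1, b2, hb2, b3, hb3, b4, b6, e4, e6⟩ := reduce a1 a2 a3 a4 a6
    refine ⟨((b1, b2, b3), (b4, b6)), ?_, ?_⟩
    · rw [Kset, Finset.mem_product, Finset.mem_product]
      exact ⟨hb1, hb2, hb3⟩
    · rw [e4] at h4
      rw [e6] at h6
      ext
      · simp only [Phi]; linarith
      · simp only [Phi]; linarith
  · rintro ⟨⟨⟨b1, b2, b3⟩, b4, b6⟩, -, rfl⟩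
    refine ⟨b1, b2, b3, b4, b6, ?_, ?_⟩
    · simp only [Phi]; ring
    · simp only [Phi]; ring

/-- Offset of the invariant `I` in a class. -/
noncomputable def alph (k : ℤ × ℤ × ℤ) : ℝ :=
  ((k.1 ^ 2 + 4 * k.2.1) ^ 2 - 24 * (k.1 * k.2.2)) / 16

/-- Offset of the invariant `J` in a class. -/
noncomputable def bet (k : ℤ × ℤ × ℤ) (m : ℤ) : ℝ :=
  (-(k.1 ^ 2 + 4 * k.2.1) ^ 3 + 36 * (k.1 ^ 2 + 4 * k.2.1) * (2 * m + k.1 * k.2.2)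
    - 216 * k.2.2 ^ 2) / 32

lemma Phi_fst (x : (ℤ × ℤ × ℤ) × (ℤ × ℤ)) : ((Phi x).1 : ℝ) = alph x.1 - 3 * x.2.1 := by
  simp only [Phi, alph, wc4]
  push_cast
  ring

lemma Phi_snd (x : (ℤ × ℤ × ℤ) × (ℤ × ℤ)) :
    ((Phi x).2 : ℝ) = bet x.1 x.2.1 - 27 * x.2.2 := by
  simp only [Phi, bet, wc6]
  push_cast
  ring

lemma height_iff (p : ℚ × ℚ) (s : ℝ) (hs : 1 ≤ s) :
    ((Hpair p : ℚ) : ℝ) < s ^ 6 ↔ |(p.1 : ℝ)| < s ^ 2 ∧ |(p.2 : ℝ)| < 2 * s ^ 3 := by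
  simp only [Hpair]
  push_cast
  rw [max_lt_iff]
  have e1 : s ^ 6 = (s ^ 2) ^ 3 := by ring
  have h1 : |(p.1 : ℝ)| ^ 3 < s ^ 6 ↔ |(p.1 : ℝ)| < s ^ 2 := by
    rw [e1]
    exact pow_lt_pow_iff_left₀ (abs_nonneg _) (by positivity) (by norm_num)
  have h2 : (p.2 : ℝ) ^ 2 / 4 < s ^ 6 ↔ |(p.2 : ℝ)| < 2 * s ^ 3 := by
    have h3 : 0 ≤ 2 * s ^ 3 := by positivity
    have h4 := sq_lt_sq (a := (p.2 : ℝ)) (b := 2 * s ^ 3)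
    rw [abs_of_nonneg h3] at h4
    rw [← h4]
    constructor <;> intro h <;> nlinarith
  rw [h1, h2]

lemma pos_iff (p : ℚ × ℚ) : 0 < Δpair p ↔ (p.2 : ℝ) ^ 2 < 4 * (p.1 : ℝ) ^ 3 := by
  have : (p.2 : ℝ) ^ 2 < 4 * (p.1 : ℝ) ^ 3 ↔ p.2 ^ 2 < 4 * p.1 ^ 3 := by exact_mod_cast Iff.rfl
  rw [this, Δpair]
  constructor <;> intro h <;> linarith

lemma neg_iff (p : ℚ × ℚ) : Δpair p < 0 ↔ 4 * (p.1 : ℝ) ^ 3 < (p.2 : ℝ) ^ 2 := by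
  have : 4 * (p.1 : ℝ) ^ 3 < (p.2 : ℝ) ^ 2 ↔ 4 * p.1 ^ 3 < p.2 ^ 2 := by exact_mod_cast Iff.rfl
  rw [this, Δpair]
  constructor <;> intro h <;> linarith

/-- Assembling the count from the twelve classes. -/
lemma assemble (S : Set (ℚ × ℚ)) (A : (ℤ × ℤ × ℤ) → Set (ℤ × ℤ)) (g e : ℝ)
    (hS : S = Phi '' {x | x.1 ∈ Kset ∧ x.2 ∈ A x.1})
    (hA : ∀ k, (A k).Finite ∧ |((A k).ncard : ℝ) - g| ≤ e) :
    |(S.ncard : ℝ) - 12 * g| ≤ 12 * e := by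
  have hinj : Set.InjOn Phi {x | x.1 ∈ Kset ∧ x.2 ∈ A x.1} :=
    Phi_injOn.mono (fun x hx => hx.1)
  rw [hS, hinj.ncard_image]
  have hK : Kset.card = 12 := by decide
  have := (ncard_fibre {x : (ℤ × ℤ × ℤ) × (ℤ × ℤ) | x.1 ∈ Kset ∧ x.2 ∈ A x.1} Kset
    (fun p hp => hp.1) (fun _ => g) e (by
      intro m hm
      have : {t | (m, t) ∈ {x : (ℤ × ℤ × ℤ) × (ℤ × ℤ) | x.1 ∈ Kset ∧ x.2 ∈ A x.1}} = A m := by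
        ext t
        simp [hm]
      rw [this]
      exact hA m)).2
  rw [Finset.sum_const, hK, nsmul_eq_mul] at this
  exact_mod_cast this

/-- There is a constant `C` such that for all `X ≥ 1`, the number of eligible pairs of
positive (resp. negative) discriminant and height `< X` is `(32/135)X^{5/6} + O(X^{1/2})`
(resp. `(128/135)X^{5/6} + O(X^{1/2})`), with error at most `C·X^{1/2}`. -/
theorem stmt13 (P Q : MvPolynomial (Fin 10) ℚ) (hPQ : IsInvariantPair ℚ P Q) :
    ∃ C : ℝ, ∀ X : ℝ, 1 ≤ X →
      |(Set.ncard {p : ℚ × ℚ | Eligible P Q p.1 p.2 ∧ 0 < Δpair p ∧ (Hpair p : ℝ) < X} : ℝ)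
          - (32/135) * X ^ ((5 : ℝ)/6)| ≤ C * X ^ ((1 : ℝ)/2) ∧
      |(Set.ncard {p : ℚ × ℚ | Eligible P Q p.1 p.2 ∧ Δpair p < 0 ∧ (Hpair p : ℝ) < X} : ℝ)
          - (128/135) * X ^ ((5 : ℝ)/6)| ≤ C * X ^ ((1 : ℝ)/2) := by
  refine ⟨120, fun X hX => ?_⟩
  have hX0 : 0 ≤ X := by linarith
  set s : ℝ := X ^ ((1 : ℝ) / 6) with hs
  have hs1 : 1 ≤ s := Real.one_le_rpow hX (by norm_num)
  have e6 : X = s ^ 6 := by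
    rw [hs, ← Real.rpow_natCast, ← Real.rpow_mul hX0]
    norm_num
  have e5 : X ^ ((5 : ℝ) / 6) = s ^ 5 := by
    rw [hs, ← Real.rpow_natCast, ← Real.rpow_mul hX0]
    norm_num
  have e3 : X ^ ((1 : ℝ) / 2) = s ^ 3 := by
    rw [hs, ← Real.rpow_natCast, ← Real.rpow_mul hX0]
    norm_num
  clear_value s
  rw [e5, e3]
  subst e6
  constructor
  · have h := assemble
      {p : ℚ × ℚ | Eligible P Q p.1 p.2 ∧ 0 < Δpair p ∧ (Hpair p : ℝ) < s ^ 6}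
      (fun k => Apos (alph k) (bet k) s) (8 / 405 * s ^ 5) (10 * s ^ 3) (by
        ext p
        simp only [Set.mem_ofPred_eq, Set.mem_image, eligible_iff_Phi P Q hPQ]
        constructor
        · rintro ⟨⟨x, hx, rfl⟩, hΔ, hH⟩
          rw [pos_iff, Phi_fst, Phi_snd] at hΔ
          rw [height_iff _ _ hs1, Phi_fst, Phi_snd] at hH
          exact ⟨x, ⟨hx, hΔ, hH⟩, rfl⟩
        · rintro ⟨x, ⟨hx, hΔ, hH⟩, rfl⟩
          refine ⟨⟨x, hx, rfl⟩, ?_, ?_⟩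
          · rw [pos_iff, Phi_fst, Phi_snd]
            exact hΔ
          · rw [height_iff _ _ hs1, Phi_fst, Phi_snd]
            exact hH)
      (fun k => count_pos _ _ s hs1)
    convert h using 1
    · congr 1
      ring
    · ring
  · have h := assemble
      {p : ℚ × ℚ | Eligible P Q p.1 p.2 ∧ Δpair p < 0 ∧ (Hpair p : ℝ) < s ^ 6}
      (fun k => Aneg (alph k) (bet k) s) (32 / 405 * s ^ 5) (10 * s ^ 3) (by
        ext p
        simp only [Set.mem_ofPred_eq, Set.mem_image, eligible_iff_Phi P Q hPQ]
        constructor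
        · rintro ⟨⟨x, hx, rfl⟩, hΔ, hH⟩
          rw [neg_iff, Phi_fst, Phi_snd] at hΔ
          rw [height_iff _ _ hs1, Phi_fst, Phi_snd] at hH
          exact ⟨x, ⟨hx, hΔ, hH⟩, rfl⟩
        · rintro ⟨x, ⟨hx, hΔ, hH⟩, rfl⟩
          refine ⟨⟨x, hx, rfl⟩, ?_, ?_⟩
          · rw [neg_iff, Phi_fst, Phi_snd]
            exact hΔ
          · rw [height_iff _ _ hs1, Phi_fst, Phi_snd]
            exact hH)
      (fun k => count_neg _ _ s hs1)
    convert h using 1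
    · congr 1
      ring
    · ring
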